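/- Let (M,ρ) be a finite pseudometric space and 𝒢 = (G,w) a generalized minimal filling of (M,ρ) whose type G is a tree in which every vertex of degree 1 is boundary. Then for any two adjacent edges of G (two edges sharing a common vertex) there exists an exact path of 𝒢 containing both edges. -/

import Mathlib

open scoped BigOperators

namespace MinFill

variable {V : Type*}

/-- The total weight of a (generalized) weighted graph: the sum of the weights
of its edges. -/
noncomputable def graphWeight (G : SimpleGraph V) (w : Sym2 V → ℝ) : ℝ :=
  ∑ᶠ e ∈ G.edgeSet, w e

/-- The weight of a walk: the sum of the weights of its edges. -/
def walkWeight {G : SimpleGraph V} (w : Sym2 V → ℝ) {u v : V} (p : G.Walk u v) : ℝ :=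
  (p.edges.map w).sum

/-- `dw G w u v` is the minimum over simple paths in `G` from `u` to `v` of the
sum of the weights of their edges. -/
noncomputable def dw (G : SimpleGraph V) (w : Sym2 V → ℝ) (u v : V) : ℝ :=
  sInf {r : ℝ | ∃ p : G.Walk u v, p.IsPath ∧ walkWeight w p = r}

/-- The degree of a vertex: the number of edges incident to it. -/
noncomputable def deg (G : SimpleGraph V) (v : V) : ℕ :=
  (G.neighborSet v).ncard

/-- `ρ` is a pseudometric on the subset `M`: symmetric, nonnegative, vanishing
on the diagonal and satisfying the triangle inequality. -/
def IsPseudometricOn (M : Set V) (ρ : V → V → ℝ) : Prop :=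
  (∀ p ∈ M, ∀ q ∈ M, ρ p q = ρ q p) ∧
  (∀ p ∈ M, ∀ q ∈ M, 0 ≤ ρ p q) ∧
  (∀ p ∈ M, ρ p p = 0) ∧
  (∀ p ∈ M, ∀ q ∈ M, ∀ r ∈ M, ρ p r ≤ ρ p q + ρ q r)

/-- `(G, w)` is a generalized filling of `(M, ρ)` (with `M ⊆ V`): `G` is
connected (and joins `M`), and for all boundary points `p, q ∈ M` every simple
path in `G` from `p` to `q` has weight at least `ρ p q` (equivalently
`ρ p q ≤ d_w(p, q)`). -/
def IsGenFilling (G : SimpleGraph V) (w : Sym2 V → ℝ) (M : Set V) (ρ : V → V → ℝ) : Prop :=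
  G.Connected ∧ ∀ p ∈ M, ∀ q ∈ M, ∀ γ : G.Walk p q, γ.IsPath → ρ p q ≤ walkWeight w γ


/-- `ρ` is a pseudometric on the finite set `M`. -/
def IsPseudometric {M : Type*} (ρ : M → M → ℝ) : Prop :=
  (∀ p q, ρ p q = ρ q p) ∧ (∀ p q, 0 ≤ ρ p q) ∧ (∀ p, ρ p p = 0) ∧
    (∀ p q r, ρ p r ≤ ρ p q + ρ q r)

/-- `(G, w)` is a generalized filling of `(M, ρ)`, where the boundary `M` is
embedded into the vertex set via `ι`. -/
def IsGenFillingE {M V : Type*} (G : SimpleGraph V) (ι : M ↪ V) (w : Sym2 V → ℝ)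
    (ρ : M → M → ℝ) : Prop :=
  G.Connected ∧ ∀ p q : M, ∀ γ : G.Walk (ι p) (ι q), γ.IsPath → ρ p q ≤ walkWeight w γ

/-- The type `G` is a tree in which every vertex of degree 1 is boundary. -/
def GoodType {M V : Type*} (G : SimpleGraph V) (ι : M ↪ V) : Prop :=
  G.IsTree ∧ ∀ v : V, deg G v = 1 → v ∈ Set.range ι

/-- The generalized minimal filling weight `mf₋(M)`: the infimum of total
weight over all generalized fillings of `(M, ρ)` whose type is a tree in which
every vertex of degree 1 is boundary. -/
noncomputable def mfNeg (M : Type) [Fintype M] (ρ : M → M → ℝ) : ℝ :=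
  sInf {r : ℝ | ∃ (V : Type) (_ : Fintype V) (G : SimpleGraph V) (ι : M ↪ V)
    (w : Sym2 V → ℝ),
      IsGenFillingE G ι w ρ ∧ GoodType G ι ∧ r = graphWeight G w}

/-- The minimal filling weight `mf(M)`: the infimum of total weight over all
fillings of `(M, ρ)` (with nonnegative weight functions). -/
noncomputable def mf (M : Type) [Fintype M] (ρ : M → M → ℝ) : ℝ :=
  sInf {r : ℝ | ∃ (V : Type) (_ : Fintype V) (G : SimpleGraph V) (ι : M ↪ V)
    (w : Sym2 V → ℝ),
      IsGenFillingE G ι w ρ ∧ (∀ e ∈ G.edgeSet, 0 ≤ w e) ∧ r = graphWeight G w}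

open SimpleGraph

section Nonneg

variable {V : Type*} [Fintype V] {G : SimpleGraph V}

theorem graphWeight_eq_sum [DecidableEq V] [DecidableRel G.Adj] (w : Sym2 V → ℝ) :
    graphWeight G w = ∑ e ∈ G.edgeFinset, w e := by
  rw [graphWeight, ← coe_edgeFinset, finsum_mem_coe_finset]

theorem sum_neighborFinset_weight [DecidableEq V] [DecidableRel G.Adj] (w : Sym2 V → ℝ) :
    ∑ a, ∑ b ∈ G.neighborFinset a, w s(a, b) = 2 * graphWeight G w := by
  have hdart : ∑ a, ∑ b ∈ G.neighborFinset a, w s(a, b) = ∑ d : G.Dart, w d.edge := by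
    rw [Finset.sum_sigma']
    refine Finset.sum_bij' (fun x hx => ⟨(x.1, x.2), by simpa using hx⟩)
      (fun d _ => ⟨d.fst, d.snd⟩) ?_ ?_ ?_ ?_ ?_
    · simp
    · simp
    · simp
    · simp
    · intro x _
      rfl
  rw [hdart, graphWeight_eq_sum, ← Finset.sum_fiberwise_of_maps_to (t := G.edgeFinset)
    (g := fun d : G.Dart => d.edge) (fun d _ => by simp), Finset.mul_sum]
  refine Finset.sum_congr rfl fun e he => ?_
  rw [Finset.sum_congr rfl (g := fun _ => w e) (fun d hd => by
    rw [(Finset.mem_filter.mp hd).2])]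
  rw [Finset.sum_const, G.dart_edge_fiber_card e (by simpa using he)]
  simp

theorem walkWeight_cons {V : Type*} {G : SimpleGraph V} (w : Sym2 V → ℝ) {a b c : V}
    (h : G.Adj a b) (p : G.Walk b c) :
    walkWeight w (Walk.cons h p) = w s(a, b) + walkWeight w p := by
  simp [walkWeight]

/-- In an acyclic graph a path is extended to a path by any non-backtracking step. -/
theorem isPath_cons_cons {V : Type*} {G : SimpleGraph V} (hG : G.IsAcyclic) {a b c l : V}
    {q : G.Walk a l} {h : G.Adj b a} (hp : (Walk.cons h q).IsPath) (hcb : G.Adj c b)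
    (hca : c ≠ a) : (Walk.cons hcb (Walk.cons h q)).IsPath := by
  rw [Walk.cons_isPath_iff]
  refine ⟨hp, fun hmem => hca ?_⟩
  simpa using hG.eq_snd_of_adj_start hp hcb.symm hmem

variable [DecidableEq V] [DecidableRel G.Adj]

/-- The expected weight of the first `n` steps of the random non-backtracking walk which starts
with the step from `a` to `b` and stops at vertices of degree one. -/
noncomputable def meanExitWeight (G : SimpleGraph V) [DecidableRel G.Adj] (w : Sym2 V → ℝ) :
    ℕ → V → V → ℝ
  | 0, _, _ => 0
  | n + 1, a, b => w s(a, b) +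
      ((G.degree b : ℝ) - 1)⁻¹ * ∑ c ∈ (G.neighborFinset b).erase a, meanExitWeight G w n b c

theorem meanExitWeight_succ_eq (hG : G.IsAcyclic) (w : Sym2 V → ℝ) (n : ℕ) :
    ∀ {a b l : V} (q : G.Walk a l) (h : G.Adj b a), (Walk.cons h q).IsPath →
      Fintype.card V ≤ q.length + 1 + n →
      meanExitWeight G w (n + 1) a b = meanExitWeight G w n a b := by
  induction n with
  | zero =>
    intro a b l q h hp hn
    have := hp.length_lt
    simp at this
    omega
  | succ n ih =>
    intro a b l q h hp hn
    rw [meanExitWeight, meanExitWeight]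
    congr 2
    refine Finset.sum_congr rfl fun c hc => ?_
    rw [Finset.mem_erase, mem_neighborFinset] at hc
    refine ih (Walk.cons h q) hc.2.symm (isPath_cons_cons hG hp hc.2.symm hc.1) ?_
    simp
    omega

theorem walkWeight_add_meanExitWeight_nonneg (hG : G.IsAcyclic) (w : Sym2 V → ℝ) {l : V}
    (hl : ∀ x, G.degree x = 1 → ∀ p : G.Walk x l, p.IsPath → 0 ≤ walkWeight w p) (n : ℕ) :
    ∀ {a b : V} (q : G.Walk a l) (h : G.Adj b a), (Walk.cons h q).IsPath →
      Fintype.card V ≤ q.length + 1 + n → 0 ≤ walkWeight w q + meanExitWeight G w n a b := by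
  induction n with
  | zero =>
    intro a b q h hp hn
    have := hp.length_lt
    simp at this
    omega
  | succ n ih =>
    intro a b q h hp hn
    have hab : a ∈ G.neighborFinset b := by simpa using h
    have hcard : (((G.neighborFinset b).erase a).card : ℝ) = (G.degree b : ℝ) - 1 := by
      rw [Finset.card_erase_of_mem hab, card_neighborFinset_eq_degree,
        Nat.cast_pred (by rw [degree_pos_iff_exists_adj]; exact ⟨a, h⟩)]
    have hsum : 0 ≤ ∑ c ∈ (G.neighborFinset b).erase a,
        (walkWeight w (Walk.cons h q) + meanExitWeight G w n b c) := by
      refine Finset.sum_nonneg fun c hc => ?_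
      rw [Finset.mem_erase, mem_neighborFinset] at hc
      refine ih (Walk.cons h q) hc.2.symm (isPath_cons_cons hG hp hc.2.symm hc.1) ?_
      simp
      omega
    rw [Finset.sum_add_distrib, Finset.sum_const, nsmul_eq_mul, hcard] at hsum
    rw [meanExitWeight, Sym2.eq_swap]
    by_cases hb : G.degree b = 1
    · have := hl b hb _ hp
      rw [walkWeight_cons] at this
      simp [hb]
      linarith
    · have hpos : 0 < (G.degree b : ℝ) - 1 := by
        have h1 : 0 < G.degree b := by rw [degree_pos_iff_exists_adj]; exact ⟨a, h⟩
        have h2 : (1 : ℝ) < G.degree b := by exact_mod_cast (by omega : 1 < G.degree b)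
        linarith
      have := mul_nonneg (inv_nonneg.mpr hpos.le) hsum
      rw [mul_add, inv_mul_cancel_left₀ hpos.ne', walkWeight_cons] at this
      linarith

/-- A weighted finite tree has nonnegative weight as soon as all its paths between vertices of
degree one have nonnegative weight. -/
theorem graphWeight_nonneg_of_leaf_paths (hG : G.IsAcyclic) (w : Sym2 V → ℝ)
    (hw : ∀ x y, G.degree x = 1 → G.degree y = 1 → ∀ p : G.Walk x y, p.IsPath →
      0 ≤ walkWeight w p) : 0 ≤ graphWeight G w := by
  set n := Fintype.card V
  set h := meanExitWeight G w n with hh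
  have hpath {a b : V} (hab : G.Adj a b) : (Walk.cons hab.symm (Walk.nil : G.Walk a a)).IsPath := by
    simpa using hab.ne'
  have hstep : ∀ a, ∀ b ∈ G.neighborFinset a, w s(a, b) = h a b -
      ((G.degree b : ℝ) - 1)⁻¹ * ∑ c ∈ (G.neighborFinset b).erase a, h b c := by
    intro a b hab
    rw [mem_neighborFinset] at hab
    have := meanExitWeight_succ_eq hG w n _ _ (hpath hab) (by simp [n])
    rw [meanExitWeight] at this
    rw [hh, ← this]
    ring
  have hinner : ∀ b, ∑ a ∈ G.neighborFinset b,
      ((G.degree b : ℝ) - 1)⁻¹ * ∑ c ∈ (G.neighborFinset b).erase a, h b c =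
      if G.degree b = 1 then 0 else ∑ c ∈ G.neighborFinset b, h b c := by
    intro b
    split_ifs with hb
    · simp [hb]
    · rw [← Finset.mul_sum]
      have : ∑ a ∈ G.neighborFinset b, ∑ c ∈ (G.neighborFinset b).erase a, h b c =
          ((G.degree b : ℝ) - 1) * ∑ c ∈ G.neighborFinset b, h b c := by
        rw [Finset.sum_congr rfl fun a ha => Finset.sum_erase_eq_sub ha, Finset.sum_sub_distrib,
          Finset.sum_const, card_neighborFinset_eq_degree, nsmul_eq_mul]
        ring
      rw [this, inv_mul_cancel_left₀]
      rw [sub_ne_zero]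
      exact_mod_cast hb
  have hswap : ∑ a, ∑ b ∈ G.neighborFinset a,
      ((G.degree b : ℝ) - 1)⁻¹ * ∑ c ∈ (G.neighborFinset b).erase a, h b c =
      ∑ b, ∑ a ∈ G.neighborFinset b,
      ((G.degree b : ℝ) - 1)⁻¹ * ∑ c ∈ (G.neighborFinset b).erase a, h b c := by
    refine Finset.sum_comm' fun a b => ?_
    simp [adj_comm]
  have hsum : 2 * graphWeight G w =
      ∑ b, if G.degree b = 1 then ∑ c ∈ G.neighborFinset b, h b c else 0 := by
    rw [← sum_neighborFinset_weight,
      Finset.sum_congr rfl fun a _ => Finset.sum_congr rfl (hstep a)]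
    simp only [Finset.sum_sub_distrib]
    rw [hswap, ← Finset.sum_sub_distrib]
    refine Finset.sum_congr rfl fun b _ => ?_
    rw [hinner]
    split_ifs <;> simp
  have : 0 ≤ 2 * graphWeight G w := by
    rw [hsum]
    refine Finset.sum_nonneg fun b _ => ?_
    split_ifs with hb
    · refine Finset.sum_nonneg fun c hc => ?_
      rw [mem_neighborFinset] at hc
      simpa [walkWeight] using walkWeight_add_meanExitWeight_nonneg hG w
        (fun x hx => hw x b hx hb) n _ _ (hpath hc) (by simp [n])
    · rfl
  linarith

end Nonneg

theorem deg_eq_degree {V : Type*} (G : SimpleGraph V) (v : V) [Fintype (G.neighborSet v)] :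
    deg G v = G.degree v := by
  rw [deg, Set.ncard_eq_toFinset_card', ← card_neighborFinset_eq_degree, neighborFinset]

theorem graphWeight_nonneg {M V : Type*} [Fintype V] {G : SimpleGraph V} {ι : M ↪ V}
    {w : Sym2 V → ℝ} {ρ : M → M → ℝ} (hρ : ∀ p q, 0 ≤ ρ p q) (hfill : IsGenFillingE G ι w ρ)
    (htype : GoodType G ι) : 0 ≤ graphWeight G w := by
  classical
  refine graphWeight_nonneg_of_leaf_paths htype.1.isAcyclic w fun x y hx hy p hp => ?_
  obtain ⟨x, rfl⟩ := htype.2 x (by rw [deg_eq_degree, hx])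
  obtain ⟨y, rfl⟩ := htype.2 y (by rw [deg_eq_degree, hy])
  exact (hρ x y).trans (hfill.2 x y p hp)

theorem mfNeg_le {M V : Type} [Fintype M] [Fintype V] {G : SimpleGraph V} {ι : M ↪ V}
    {w : Sym2 V → ℝ} {ρ : M → M → ℝ} (hρ : ∀ p q, 0 ≤ ρ p q) (hfill : IsGenFillingE G ι w ρ)
    (htype : GoodType G ι) : mfNeg M ρ ≤ graphWeight G w := by
  refine csInf_le ⟨0, ?_⟩ ⟨V, inferInstance, G, ι, w, hfill, htype, rfl⟩
  rintro r ⟨V, _, G, ι, w, hfill, htype, rfl⟩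
  exact graphWeight_nonneg hρ hfill htype

section Split

variable {V : Type*} {G : SimpleGraph V} {v u₁ u₂ : V}

/-- The graph obtained from `G` by detaching the edges `v u₁` and `v u₂` from `v` and attaching
them to a new vertex `none`, which is joined to `v` by a new edge. -/
def splitGraph (G : SimpleGraph V) (v u₁ u₂ : V) : SimpleGraph (Option V) where
  Adj
    | some a, some b => G.Adj a b ∧ s(a, b) ≠ s(v, u₁) ∧ s(a, b) ≠ s(v, u₂)
    | none, some b => b = v ∨ b = u₁ ∨ b = u₂
    | some a, none => a = v ∨ a = u₁ ∨ a = u₂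
    | none, none => False
  symm := ⟨by
    rintro (_ | a) (_ | b) h
    · exact h
    · exact h
    · exact h
    · simpa only [Sym2.eq_swap, G.adj_comm] using h⟩
  loopless := ⟨by
    rintro (_ | a) h
    · exact h
    · exact G.irrefl h.1⟩

@[simp]
theorem splitGraph_adj_some_some {a b : V} : (splitGraph G v u₁ u₂).Adj (some a) (some b) ↔
    G.Adj a b ∧ s(a, b) ≠ s(v, u₁) ∧ s(a, b) ≠ s(v, u₂) := Iff.rfl

@[simp]
theorem splitGraph_adj_none_some {b : V} : (splitGraph G v u₁ u₂).Adj none (some b) ↔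
    b = v ∨ b = u₁ ∨ b = u₂ := Iff.rfl

@[simp]
theorem splitGraph_adj_some_none {a : V} : (splitGraph G v u₁ u₂).Adj (some a) none ↔
    a = v ∨ a = u₁ ∨ a = u₂ := Iff.rfl

/-- The map on edges induced by contracting the edge between `none` and `some v`. -/
def collapseEdge (v : V) : Sym2 (Option V) → Sym2 V := Sym2.map fun x => x.getD v

@[simp]
theorem collapseEdge_mk (x y : Option V) :
    collapseEdge v s(x, y) = s(x.getD v, y.getD v) := rfl

theorem adj_getD_of_splitGraph_adj (h₁ : G.Adj v u₁) (h₂ : G.Adj v u₂) {x y : Option V}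
    (h : (splitGraph G v u₁ u₂).Adj x y) (hne : s(x, y) ≠ s(none, some v)) :
    G.Adj (x.getD v) (y.getD v) := by
  rcases x with _ | a <;> rcases y with _ | b
  · exact ((splitGraph G v u₁ u₂).irrefl h).elim
  · rcases h with rfl | rfl | rfl
    · simp at hne
    · exact h₁
    · exact h₂
  · rcases h with rfl | rfl | rfl
    · simp at hne
    · exact h₁.symm
    · exact h₂.symm
  · exact h.1

theorem collapseEdge_bijOn (h₁ : G.Adj v u₁) (h₂ : G.Adj v u₂) :
    Set.BijOn (collapseEdge v) ((splitGraph G v u₁ u₂).edgeSet \ {s(none, some v)})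
      G.edgeSet := by
  refine ⟨?_, ?_, ?_⟩
  · rintro ⟨x, y⟩ ⟨hxy, hne⟩
    exact adj_getD_of_splitGraph_adj h₁ h₂ hxy hne
  · rintro ⟨x, y⟩ ⟨hxy, hne⟩ ⟨x', y'⟩ ⟨hxy', hne'⟩ heq
    rcases x with _ | a <;> rcases y with _ | b <;> rcases x' with _ | a' <;>
      rcases y' with _ | b' <;> simp at hxy hne hxy' hne' heq ⊢ <;> grind
  · rintro ⟨a, b⟩ hab
    by_cases ha : s(a, b) = s(v, u₁)
    · exact ⟨s(none, some u₁), ⟨by simp, by simpa using h₁.ne'⟩, by simpa using ha.symm⟩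
    · by_cases hb : s(a, b) = s(v, u₂)
      · exact ⟨s(none, some u₂), ⟨by simp, by simpa using h₂.ne'⟩, by simpa using hb.symm⟩
      · exact ⟨s(some a, some b), ⟨⟨hab, ha, hb⟩, by simp⟩, rfl⟩

theorem splitGraph_connected (hG : G.Connected) (v u₁ u₂ : V) :
    (splitGraph G v u₁ u₂).Connected := by
  have hnone {b : V} (hb : b = v ∨ b = u₁ ∨ b = u₂) :
      (splitGraph G v u₁ u₂).Reachable none (some b) :=
    Adj.reachable (splitGraph_adj_none_some.mpr hb)
  have hadj {a b : V} (hab : G.Adj a b) :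
      (splitGraph G v u₁ u₂).Reachable (some a) (some b) := by
    by_cases h : s(a, b) = s(v, u₁) ∨ s(a, b) = s(v, u₂)
    · exact (hnone (by grind)).symm.trans (hnone (by grind))
    · push Not at h
      exact Adj.reachable (splitGraph_adj_some_some.mpr ⟨hab, h⟩)
  have hwalk {a b : V} (p : G.Walk a b) :
      (splitGraph G v u₁ u₂).Reachable (some a) (some b) := by
    induction p with
    | nil => exact Reachable.refl _
    | cons h _ ih => exact (hadj h).trans ih
  refine (connected_iff_exists_forall_reachable _).mpr ⟨none, ?_⟩
  rintro (_ | b)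
  · exact Reachable.refl _
  · exact (hnone (.inl rfl)).trans (hwalk (hG v b).some)

variable [DecidableEq V]

theorem exists_walk_edges_eq_collapse (h₁ : G.Adj v u₁) (h₂ : G.Adj v u₂) {x y : Option V}
    (p : (splitGraph G v u₁ u₂).Walk x y) :
    ∃ q : G.Walk (x.getD v) (y.getD v),
      q.edges = (p.edges.filter (· ≠ s(none, some v))).map (collapseEdge v) := by
  induction p with
  | nil => exact ⟨Walk.nil, by simp⟩
  | @cons x y z h p ih =>
    obtain ⟨q, hq⟩ := ih
    by_cases hne : s(x, y) = s(none, some v)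
    · have hxy : y.getD v = x.getD v := by
        rcases Sym2.eq_iff.mp hne with ⟨rfl, rfl⟩ | ⟨rfl, rfl⟩ <;> rfl
      exact ⟨q.copy hxy rfl, by simp [hne, hq]⟩
    · exact ⟨Walk.cons (adj_getD_of_splitGraph_adj h₁ h₂ h hne) q, by simp [hne, hq]⟩

theorem exists_isPath_edges_eq_collapse (hG : G.IsAcyclic) (h₁ : G.Adj v u₁) (h₂ : G.Adj v u₂)
    {x y : Option V} {p : (splitGraph G v u₁ u₂).Walk x y} (hp : p.IsTrail) :
    ∃ q : G.Walk (x.getD v) (y.getD v), q.IsPath ∧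
      q.edges = (p.edges.filter (· ≠ s(none, some v))).map (collapseEdge v) := by
  obtain ⟨q, hq⟩ := exists_walk_edges_eq_collapse h₁ h₂ p
  refine ⟨q, (hG.isPath_iff_isTrail q).mpr ⟨?_⟩, hq⟩
  rw [hq]
  refine List.Nodup.map_on (fun e he e' he' heq => ?_) (hp.edges_nodup.filter _)
  simp only [List.mem_filter, decide_eq_true_eq] at he he'
  exact (collapseEdge_bijOn h₁ h₂).injOn ⟨p.edges_subset_edgeSet he.1, he.2⟩
    ⟨p.edges_subset_edgeSet he'.1, he'.2⟩ heq

theorem splitGraph_isAcyclic (hG : G.IsAcyclic) (h₁ : G.Adj v u₁) (h₂ : G.Adj v u₂) :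
    (splitGraph G v u₁ u₂).IsAcyclic := by
  intro x c hc
  obtain ⟨q, hq, hedges⟩ := exists_isPath_edges_eq_collapse hG h₁ h₂ hc.isTrail
  rw [Walk.edges_eq_nil.mpr (Walk.isPath_iff_nil.mp hq), eq_comm, List.map_eq_nil_iff,
    List.filter_eq_nil_iff] at hedges
  have hle : c.edges.length ≤ [s(none, some v)].length :=
    (List.subperm_of_subset hc.isTrail.edges_nodup
      (fun e he => by simpa using hedges e he)).length_le
  have := hc.three_le_length
  simp at hle
  omega

theorem splitGraph_isTree (hG : G.IsTree) (h₁ : G.Adj v u₁) (h₂ : G.Adj v u₂) :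
    (splitGraph G v u₁ u₂).IsTree :=
  ⟨splitGraph_connected hG.connected v u₁ u₂, splitGraph_isAcyclic hG.isAcyclic h₁ h₂⟩

theorem splitGraph_goodType {M : Type*} {ι : M ↪ V} (hG : GoodType G ι) (h₁ : G.Adj v u₁)
    (h₂ : G.Adj v u₂)
    (hv : v ∈ Set.range ι ∨ ∃ u, G.Adj v u ∧ u ≠ u₁ ∧ u ≠ u₂) :
    GoodType (splitGraph G v u₁ u₂) (ι.trans Function.Embedding.some) := by
  refine ⟨splitGraph_isTree hG.1 h₁ h₂, fun x hx => ?_⟩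
  obtain ⟨y, hy⟩ := Set.ncard_eq_one.mp hx
  have hmem (z : Option V) : (splitGraph G v u₁ u₂).Adj x z ↔ z = y := by
    rw [← mem_neighborSet, hy, Set.mem_singleton_iff]
  rcases x with _ | a
  · have e₁ := (hmem (some v)).mp (by simp)
    have e₂ := (hmem (some u₁)).mp (by simp)
    exact (h₁.ne (Option.some_injective _ (e₁.trans e₂.symm))).elim
  · suffices a ∈ Set.range ι by
      obtain ⟨m, rfl⟩ := this
      exact ⟨m, rfl⟩
    by_cases hav : a = v
    · subst hav
      refine hv.resolve_right ?_
      rintro ⟨u, hu, hu₁, hu₂⟩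
      have e₁ := (hmem none).mp (by simp)
      have e₂ := (hmem (some u)).mp (by simp [hu, hu₁, hu₂, hu.ne'])
      simpa using e₁.trans e₂.symm
    · refine hG.2 a (Set.ncard_eq_one.mpr ⟨y.getD v, ?_⟩)
      ext b
      rw [mem_neighborSet, Set.mem_singleton_iff]
      constructor
      · intro hab
        by_cases h : s(a, b) = s(v, u₁) ∨ s(a, b) = s(v, u₂)
        · rw [← (hmem none).mp (by rw [splitGraph_adj_some_none]; grind)]
          change b = v
          grind
        · push Not at h
          rw [← (hmem (some b)).mp ⟨hab, h⟩]
          rfl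
      · rintro rfl
        exact adj_getD_of_splitGraph_adj h₁ h₂ ((hmem y).mpr rfl) (by simp [hav])

/-- The weights on `splitGraph G v u₁ u₂` which move the amount `ε` from each of the two detached
edges to the new edge. -/
def splitWeight (w : Sym2 V → ℝ) (v u₁ u₂ : V) (ε : ℝ) (e : Sym2 (Option V)) : ℝ :=
  (if e = s(none, some v) then ε else w (collapseEdge v e)) -
    (if e = s(none, some u₁) then ε else 0) - (if e = s(none, some u₂) then ε else 0)

theorem graphWeight_splitGraph [Fintype V] (w : Sym2 V → ℝ) (h₁ : G.Adj v u₁)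
    (h₂ : G.Adj v u₂) (ε : ℝ) :
    graphWeight (splitGraph G v u₁ u₂) (splitWeight w v u₁ u₂ ε) = graphWeight G w - ε := by
  classical
  have hmem : s(none, some v) ∈ (splitGraph G v u₁ u₂).edgeFinset := by simp
  have hmem₁ : s(none, some u₁) ∈ (splitGraph G v u₁ u₂).edgeFinset := by simp
  have hmem₂ : s(none, some u₂) ∈ (splitGraph G v u₁ u₂).edgeFinset := by simp
  have hbij := collapseEdge_bijOn h₁ h₂
  have hsum : ∑ e ∈ (splitGraph G v u₁ u₂).edgeFinset.erase s(none, some v),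
      (if e = s(none, some v) then ε else w (collapseEdge v e)) = ∑ e ∈ G.edgeFinset, w e := by
    refine Finset.sum_nbij (collapseEdge v) ?_ ?_ ?_ ?_
    · intro e he
      rw [mem_edgeFinset]
      exact hbij.mapsTo (by simpa [and_comm] using he)
    · simpa using hbij.injOn
    · simpa using hbij.surjOn
    · intro e he
      rw [if_neg (Finset.ne_of_mem_erase he)]
  rw [graphWeight_eq_sum, graphWeight_eq_sum]
  simp only [splitWeight]
  rw [Finset.sum_sub_distrib, Finset.sum_sub_distrib, Finset.sum_ite_eq', if_pos hmem₁,
    Finset.sum_ite_eq', if_pos hmem₂, ← Finset.add_sum_erase _ _ hmem, hsum, if_pos rfl]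
  ring

theorem sum_map_splitWeight (w : Sym2 V → ℝ) (v u₁ u₂ : V) (ε : ℝ)
    (l : List (Sym2 (Option V))) :
    (l.map (splitWeight w v u₁ u₂ ε)).sum =
      (((l.filter (· ≠ s(none, some v))).map (collapseEdge v)).map w).sum +
        ε * l.count s(none, some v) - ε * l.count s(none, some u₁) -
        ε * l.count s(none, some u₂) := by
  induction l with
  | nil => simp
  | cons e l ih =>
    rw [List.map_cons, List.sum_cons, ih, splitWeight]
    simp only [List.count_cons, List.filter_cons, beq_iff_eq]
    split_ifs <;> simp_all <;> ring

theorem countP_none_mem (hv₁ : v ≠ u₁) (hv₂ : v ≠ u₂) (hu : u₁ ≠ u₂)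
    {l : List (Sym2 (Option V))} (hl : ∀ e ∈ l, e ∈ (splitGraph G v u₁ u₂).edgeSet) :
    l.countP (fun e => none ∈ e) =
      l.count s(none, some v) + l.count s(none, some u₁) + l.count s(none, some u₂) := by
  induction l with
  | nil => simp
  | cons e l ih =>
    rw [List.forall_mem_cons] at hl
    simp only [List.countP_cons, List.count_cons, beq_iff_eq, ih hl.2]
    have he := hl.1
    obtain ⟨x, y⟩ := e
    rcases x with _ | a <;> rcases y with _ | b
    · simp at he
    · simp at he
      rcases he with rfl | rfl | rfl <;> simp [hv₁, hv₂, hu, hv₁.symm, hv₂.symm, hu.symm] <;> omega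
    · simp at he
      rcases he with rfl | rfl | rfl <;> simp [hv₁, hv₂, hu, hv₁.symm, hv₂.symm, hu.symm] <;> omega
    · simp

/-- A path of `splitGraph G v u₁ u₂` between old vertices comes from a path of `G`, and its weight
is smaller by `2 * ε` if that path contains both detached edges, and is the same otherwise. -/
theorem exists_isPath_walkWeight_splitWeight (hG : G.IsAcyclic) (h₁ : G.Adj v u₁)
    (h₂ : G.Adj v u₂) (hu : u₁ ≠ u₂) (w : Sym2 V → ℝ) (ε : ℝ) {a b : V}
    {p : (splitGraph G v u₁ u₂).Walk (some a) (some b)} (hp : p.IsPath) :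
    ∃ q : G.Walk a b, q.IsPath ∧
      (walkWeight (splitWeight w v u₁ u₂ ε) p = walkWeight w q ∨
        (s(v, u₁) ∈ q.edges ∧ s(v, u₂) ∈ q.edges ∧
          walkWeight (splitWeight w v u₁ u₂ ε) p = walkWeight w q - 2 * ε)) := by
  obtain ⟨q, hq, hedges⟩ : ∃ q : G.Walk a b, q.IsPath ∧
      q.edges = (p.edges.filter (· ≠ s(none, some v))).map (collapseEdge v) :=
    exists_isPath_edges_eq_collapse hG h₁ h₂ hp.isTrail
  refine ⟨q, hq, ?_⟩
  have heven := (hp.isTrail.even_countP_edges_iff none).mpr (by simp)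
  rw [countP_none_mem h₁.ne h₂.ne hu fun e he => p.edges_subset_edgeSet he] at heven
  have hcount := List.nodup_iff_count_le_one.mp hp.isTrail.edges_nodup
  have hw : walkWeight (splitWeight w v u₁ u₂ ε) p = walkWeight w q +
      ε * p.edges.count s(none, some v) - ε * p.edges.count s(none, some u₁) -
        ε * p.edges.count s(none, some u₂) := by
    rw [walkWeight, sum_map_splitWeight, ← hedges, walkWeight]
  have hmem {u : V} (huv : u ≠ v) (hc : 0 < p.edges.count s(none, some u)) :
      s(v, u) ∈ q.edges := by
    rw [hedges, List.mem_map]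
    exact ⟨s(none, some u), by simpa [huv] using List.count_pos_iff.mp hc, rfl⟩
  have hc := hcount s(none, some v)
  have hc₁ := hcount s(none, some u₁)
  have hc₂ := hcount s(none, some u₂)
  have hmem₁ := hmem h₁.ne'
  have hmem₂ := hmem h₂.ne'
  rw [hw]
  generalize p.edges.count s(none, some v) = c at *
  generalize p.edges.count s(none, some u₁) = c₁ at *
  generalize p.edges.count s(none, some u₂) = c₂ at *
  by_cases hboth : c₁ = 1 ∧ c₂ = 1
  · obtain ⟨rfl, rfl⟩ := hboth
    obtain rfl : c = 0 := by grind
    refine .inr ⟨hmem₁ one_pos, hmem₂ one_pos, ?_⟩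
    push_cast
    ring
  · obtain rfl : c = c₁ + c₂ := by grind
    left
    push_cast
    ring

theorem isGenFillingE_splitGraph {M : Type*} {ι : M ↪ V} {w : Sym2 V → ℝ} {ρ : M → M → ℝ}
    (hfill : IsGenFillingE G ι w ρ) (hG : G.IsAcyclic) (h₁ : G.Adj v u₁) (h₂ : G.Adj v u₂)
    (hu : u₁ ≠ u₂) {ε : ℝ}
    (hslack : ∀ p q, ∀ γ : G.Walk (ι p) (ι q), γ.IsPath → s(v, u₁) ∈ γ.edges →
      s(v, u₂) ∈ γ.edges → ρ p q + 2 * ε ≤ walkWeight w γ) :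
    IsGenFillingE (splitGraph G v u₁ u₂) (ι.trans Function.Embedding.some)
      (splitWeight w v u₁ u₂ ε) ρ := by
  refine ⟨splitGraph_connected hfill.1 v u₁ u₂, fun x y p hp => ?_⟩
  obtain ⟨q, hq, hpq | ⟨hq₁, hq₂, hpq⟩⟩ :=
    exists_isPath_walkWeight_splitWeight hG h₁ h₂ hu w ε hp
  · exact (hfill.2 x y q hq).trans_eq hpq.symm
  · exact (le_sub_iff_add_le.mpr (hslack x y q hq hq₁ hq₂)).trans_eq hpq.symm

end Split

section Minimal

variable {V : Type} {G : SimpleGraph V} {v u₁ u₂ : V}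

/-- If no path joining boundary points through both edges `e₁` and `e₂` is exact, then the
weights of these paths exceed the required ones by a uniform positive amount. -/
theorem exists_slack {M : Type*} [Finite M] {ι : M ↪ V} {w : Sym2 V → ℝ} {ρ : M → M → ℝ}
    (hfill : IsGenFillingE G ι w ρ) (hG : G.IsAcyclic) {e₁ e₂ : Sym2 V}
    (hne : ∀ p q, ∀ γ : G.Walk (ι p) (ι q), γ.IsPath → e₁ ∈ γ.edges → e₂ ∈ γ.edges →
      walkWeight w γ ≠ ρ p q) :
    ∃ ε : ℝ, 0 < ε ∧ ∀ p q, ∀ γ : G.Walk (ι p) (ι q), γ.IsPath → e₁ ∈ γ.edges →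
      e₂ ∈ γ.edges → ρ p q + 2 * ε ≤ walkWeight w γ := by
  have hev : ∀ p q, ∀ᶠ ε in nhdsWithin (0 : ℝ) (Set.Ioi 0), ∀ γ : G.Walk (ι p) (ι q),
      γ.IsPath → e₁ ∈ γ.edges → e₂ ∈ γ.edges → ρ p q + 2 * ε ≤ walkWeight w γ := by
    intro p q
    by_cases hex : ∃ γ : G.Walk (ι p) (ι q), γ.IsPath ∧ e₁ ∈ γ.edges ∧ e₂ ∈ γ.edges
    · obtain ⟨γ, hγ, h₁, h₂⟩ := hex
      have hlt : ρ p q < walkWeight w γ :=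
        lt_of_le_of_ne (hfill.2 p q γ hγ) (hne p q γ hγ h₁ h₂).symm
      have hmem := Ioo_mem_nhdsGT (half_pos (sub_pos.mpr hlt))
      filter_upwards [hmem] with ε hε γ' hγ' _ _
      have heq : γ' = γ :=
        congrArg Subtype.val ((hG.subsingleton_path _ _).elim ⟨γ', hγ'⟩ ⟨γ, hγ⟩)
      rw [heq]
      linarith [hε.2]
    · exact Filter.Eventually.of_forall fun ε γ hγ h₁ h₂ => (hex ⟨γ, hγ, h₁, h₂⟩).elim
  obtain ⟨ε, hε, hpos⟩ := ((Filter.eventually_all.mpr fun p => Filter.eventually_all.mpr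
    (hev p)).and self_mem_nhdsWithin).exists
  exact ⟨ε, hpos, hε⟩

/-- A path passing through an interior vertex of degree two contains both edges at it. -/
theorem mem_edges_of_degree_two (hnbr : ∀ u, G.Adj v u → u = u₁ ∨ u = u₂) {x y : V}
    (hx : x ≠ v) (hy : y ≠ v) {p : G.Walk x y} (hp : p.IsPath) (h₁ : s(v, u₁) ∈ p.edges) :
    s(v, u₂) ∈ p.edges := by
  classical
  by_contra h₂
  have heven := (hp.isTrail.even_countP_edges_iff v).mpr fun _ => ⟨hx.symm, hy.symm⟩
  have hcount : p.edges.countP (fun e => v ∈ e) = p.edges.count s(v, u₁) := by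
    rw [List.count]
    refine List.countP_congr fun e he => ?_
    simp only [decide_eq_true_eq, beq_iff_eq]
    refine ⟨fun hv => ?_, fun h => h ▸ Sym2.mem_mk_left v u₁⟩
    obtain ⟨u, rfl⟩ := hv
    rcases hnbr u (p.adj_of_mem_edges he) with rfl | rfl
    · rfl
    · exact (h₂ he).elim
  rw [hcount, List.count_eq_one_of_mem hp.isTrail.edges_nodup h₁] at heven
  exact absurd heven (by decide)

theorem walkWeight_sub_single [DecidableEq V] (w : Sym2 V → ℝ) (e : Sym2 V) (ε : ℝ) {x y : V}
    {p : G.Walk x y} (hp : p.IsPath) :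
    walkWeight (fun e' => w e' - if e' = e then ε else 0) p =
      walkWeight w p - if e ∈ p.edges then ε else 0 := by
  have hlist (l : List (Sym2 V)) : (l.map fun e' => w e' - if e' = e then ε else 0).sum =
      (l.map w).sum - l.count e * ε := by
    induction l with
    | nil => simp
    | cons a l ih =>
      simp only [List.map_cons, List.sum_cons, ih, List.count_cons, beq_iff_eq]
      split_ifs <;> push_cast <;> ring
  rw [walkWeight, hlist, hp.isTrail.edges_nodup.count, walkWeight]
  split_ifs <;> simp

theorem exists_exact_path_of_adj {M : Type} [Fintype M] [Fintype V] {ρ : M → M → ℝ}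
    (hρ : ∀ p q, 0 ≤ ρ p q) {ι : M ↪ V} {w : Sym2 V → ℝ} (hfill : IsGenFillingE G ι w ρ)
    (htype : GoodType G ι) (hmin : graphWeight G w = mfNeg M ρ)
    (h₁ : G.Adj v u₁) (h₂ : G.Adj v u₂) (hu : u₁ ≠ u₂) :
    ∃ x y : M, ∃ γ : G.Walk (ι x) (ι y), γ.IsPath ∧ s(v, u₁) ∈ γ.edges ∧
      s(v, u₂) ∈ γ.edges ∧ walkWeight w γ = ρ x y := by
  classical
  by_contra! hne
  obtain ⟨ε, hε, hslack⟩ := exists_slack hfill htype.1.isAcyclic hne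
  by_cases hv : v ∈ Set.range ι ∨ ∃ u, G.Adj v u ∧ u ≠ u₁ ∧ u ≠ u₂
  · have hle := mfNeg_le hρ
      (isGenFillingE_splitGraph hfill htype.1.isAcyclic h₁ h₂ hu hslack)
      (splitGraph_goodType htype h₁ h₂ hv)
    rw [graphWeight_splitGraph w h₁ h₂] at hle
    linarith
  · push Not at hv
    have hnbr : ∀ u, G.Adj v u → u = u₁ ∨ u = u₂ := fun u huv => by
      by_cases h : u = u₁
      · exact .inl h
      · exact .inr (hv.2 u huv h)
    have hι (m : M) : ι m ≠ v := fun h => hv.1 ⟨m, h⟩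
    have hfill' : IsGenFillingE G ι (fun e => w e - if e = s(v, u₁) then ε else 0) ρ := by
      refine ⟨hfill.1, fun x y γ hγ => ?_⟩
      rw [walkWeight_sub_single w _ ε hγ]
      split_ifs with h
      · have := hslack x y γ hγ h (mem_edges_of_degree_two hnbr (hι x) (hι y) hγ h)
        linarith
      · simpa using hfill.2 x y γ hγ
    have hle := mfNeg_le hρ hfill' htype
    have hmem : s(v, u₁) ∈ G.edgeFinset := by simpa using h₁
    rw [graphWeight_eq_sum, Finset.sum_sub_distrib, Finset.sum_ite_eq', if_pos hmem,
      ← graphWeight_eq_sum] at hle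
    linarith

end Minimal

/-- In a generalized minimal filling, any two adjacent edges
are contained in a common exact path. -/
theorem adjacent_edges_mem_exact_path (M : Type) [Fintype M] (ρ : M → M → ℝ)
    (hρ : IsPseudometric ρ) {V : Type} [Fintype V] (G : SimpleGraph V) (ι : M ↪ V)
    (w : Sym2 V → ℝ) (hfill : IsGenFillingE G ι w ρ) (htype : GoodType G ι)
    (hmin : graphWeight G w = mfNeg M ρ) :
    ∀ e₁ ∈ G.edgeSet, ∀ e₂ ∈ G.edgeSet, e₁ ≠ e₂ → (∃ v : V, v ∈ e₁ ∧ v ∈ e₂) →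
      ∃ x y : M, ∃ γ : G.Walk (ι x) (ι y),
        γ.IsPath ∧ e₁ ∈ γ.edges ∧ e₂ ∈ γ.edges ∧ walkWeight w γ = ρ x y := by
  rintro e₁ he₁ e₂ he₂ hne ⟨v, ⟨u₁, rfl⟩, ⟨u₂, rfl⟩⟩
  exact exists_exact_path_of_adj hρ.2.1 hfill htype hmin he₁ he₂ fun h => hne (h ▸ rfl)

end MinFill
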